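/- Let λ be an extremal with control u such that λ(t) ∈ Λ for all t in an interval (τ₁, τ₂), and assume h₀₁(λ(t))² + h₀₂(λ(t))² + h₁₂(λ(t))² ≠ 0 for all t ∈ (τ₁, τ₂). Then h₁₂(λ(t)) ≠ 0 on (τ₁, τ₂), for almost every t the control satisfies u₁(t) = −h₀₂(λ(t))/h₁₂(λ(t)) and u₂(t) = h₀₁(λ(t))/h₁₂(λ(t)), and consequently h₀₁(λ(t))² + h₀₂(λ(t))² ≤ h₁₂(λ(t))² for all t ∈ (τ₁, τ₂). -/

import Mathlib

noncomputable section

open MeasureTheory Real Set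

/-- The state space: ℝ³, realized as `Fin 3 → ℝ`. -/
abbrev E3 : Type := Fin 3 → ℝ

/-- Euclidean inner product on ℝ³. -/
def dot3 (a b : E3) : ℝ := ∑ i, a i * b i

/-- Lie bracket of two vector fields: `[f, g](x) = Dg(x) f(x) − Df(x) g(x)`. -/
def lie (f g : E3 → E3) : E3 → E3 :=
  fun x => fderiv ℝ g x (f x) - fderiv ℝ f x (g x)

/-- The control set: the closed unit disk in ℝ². -/
def U2 : Set (ℝ × ℝ) := {u | u.1 ^ 2 + u.2 ^ 2 ≤ 1}

/-- An admissible control on the time set `I`: measurable with values in the unit disk.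
(Essential boundedness is automatic since `U2` is bounded.) -/
def AdmControl (u : ℝ → ℝ × ℝ) (I : Set ℝ) : Prop :=
  Measurable u ∧ ∀ t ∈ I, u t ∈ U2

/-- An admissible trajectory of `q̇ = f₀(q) + u₁ f₁(q) + u₂ f₂(q)` on `I`,
with control `u`: locally Lipschitz (here: Lipschitz on `I`) and satisfying
the ODE almost everywhere on `I`. -/
def IsTraj (f0 f1 f2 : E3 → E3) (u : ℝ → ℝ × ℝ) (q : ℝ → E3) (I : Set ℝ) : Prop :=
  (∃ K, LipschitzOnWith K q I) ∧
  ∀ᵐ t, t ∈ I → HasDerivAt q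
    (f0 (q t) + (u t).1 • f1 (q t) + (u t).2 • f2 (q t)) t

/-- `q : [0, t₁] → ℝ³` is a time-optimal trajectory: it is an admissible trajectory,
and no admissible trajectory joins `q 0` to `q t₁` in time strictly less than `t₁`. -/
def TimeOpt (f0 f1 f2 : E3 → E3) (q : ℝ → E3) (t1 : ℝ) : Prop :=
  0 ≤ t1 ∧
  (∃ u, AdmControl u (Icc 0 t1) ∧ IsTraj f0 f1 f2 u q (Icc 0 t1)) ∧
  ¬ ∃ s, 0 ≤ s ∧ s < t1 ∧ ∃ u p, AdmControl u (Icc 0 s) ∧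
      IsTraj f0 f1 f2 u p (Icc 0 s) ∧ p 0 = q 0 ∧ p s = q t1

/-- For `λ = (ξ, x)`, the Hamiltonian lift `h_f(λ) = ⟨ξ, f(x)⟩` of a vector field `f`. -/
def hF (f : E3 → E3) (l : E3 × E3) : ℝ := dot3 l.1 (f l.2)

/-- The (pre-maximized) Hamiltonian `h₀ + v₁ h₁ + v₂ h₂` at `λ`, for a control value `v`. -/
def Ham (f0 f1 f2 : E3 → E3) (v : ℝ × ℝ) (l : E3 × E3) : ℝ :=
  hF f0 l + v.1 * hF f1 l + v.2 * hF f2 l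

/-- A Pontryagin extremal `λ(t) = (ξ(t), x(t))` with control `u` on the time set `I`:
locally Lipschitz, `ξ(t) ≠ 0`, satisfying a.e. the Hamiltonian system
`x' = f₀(x) + u₁ f₁(x) + u₂ f₂(x)`,
`ξ' = −(Df₀(x) + u₁ Df₁(x) + u₂ Df₂(x))ᵀ ξ` (expressed via the inner product),
the maximality condition, and nonnegativity of the maximized Hamiltonian. -/
def IsExtremal (f0 f1 f2 : E3 → E3) (u : ℝ → ℝ × ℝ) (lam : ℝ → E3 × E3)
    (I : Set ℝ) : Prop :=
  (∃ K, LipschitzOnWith K lam I) ∧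
  AdmControl u I ∧
  (∀ t ∈ I, (lam t).1 ≠ 0) ∧
  ∀ᵐ t, t ∈ I →
    (HasDerivAt (fun s => (lam s).2)
      (f0 ((lam t).2) + (u t).1 • f1 ((lam t).2) + (u t).2 • f2 ((lam t).2)) t) ∧
    (∃ w : E3, HasDerivAt (fun s => (lam s).1) w t ∧
      ∀ v : E3, dot3 w v =
        - dot3 ((lam t).1)
          (fderiv ℝ f0 ((lam t).2) v + (u t).1 • fderiv ℝ f1 ((lam t).2) v
            + (u t).2 • fderiv ℝ f2 ((lam t).2) v)) ∧
    (∀ v ∈ U2, Ham f0 f1 f2 v (lam t) ≤ Ham f0 f1 f2 (u t) (lam t)) ∧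
    0 ≤ Ham f0 f1 f2 (u t) (lam t)

/-- The singular locus `Λ = {(ξ, x) : ⟨ξ, f₁(x)⟩ = ⟨ξ, f₂(x)⟩ = 0}`. -/
def SingLocus (f1 f2 : E3 → E3) : Set (E3 × E3) :=
  {l | hF f1 l = 0 ∧ hF f2 l = 0}

theorem dot3_add_right (a b c : E3) : dot3 a (b + c) = dot3 a b + dot3 a c :=
  dotProduct_add a b c

theorem dot3_sub_right (a b c : E3) : dot3 a (b - c) = dot3 a b - dot3 a c :=
  dotProduct_sub a b c

theorem dot3_smul_right (r : ℝ) (a b : E3) : dot3 a (r • b) = r * dot3 a b :=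
  dotProduct_smul r a b

/-- Product rule for the Euclidean pairing of two curves. -/
theorem HasDerivAt.dot3 {a b : ℝ → E3} {a' b' : E3} {t : ℝ}
    (ha : HasDerivAt a a' t) (hb : HasDerivAt b b' t) :
    HasDerivAt (fun s => dot3 (a s) (b s)) (dot3 a' (b t) + dot3 (a t) b') t := by
  unfold _root_.dot3
  rw [← Finset.sum_add_distrib]
  exact HasDerivAt.fun_sum fun i _ => (hasDerivAt_pi.1 ha i).mul (hasDerivAt_pi.1 hb i)

/-- The derivative of the Hamiltonian lift `h_f` along a solution of the Hamiltonian system. -/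
theorem hasDerivAt_hF_extremal {f0 f1 f2 f : E3 → E3} {lam : ℝ → E3 × E3} {t : ℝ}
    {v : ℝ × ℝ} {w : E3} (hf : DifferentiableAt ℝ f (lam t).2)
    (hx : HasDerivAt (fun s => (lam s).2)
      (f0 ((lam t).2) + v.1 • f1 ((lam t).2) + v.2 • f2 ((lam t).2)) t)
    (hξ : HasDerivAt (fun s => (lam s).1) w t)
    (hw : ∀ y : E3, dot3 w y =
      - dot3 ((lam t).1)
        (fderiv ℝ f0 ((lam t).2) y + v.1 • fderiv ℝ f1 ((lam t).2) y
          + v.2 • fderiv ℝ f2 ((lam t).2) y)) :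
    HasDerivAt (fun s => hF f (lam s))
      (hF (lie f0 f) (lam t) + v.1 * hF (lie f1 f) (lam t) + v.2 * hF (lie f2 f) (lam t)) t := by
  have hfx := hf.hasFDerivAt.comp_hasDerivAt t hx
  refine (hξ.dot3 hfx).congr_deriv ?_
  simp only [hF, lie, hw, map_add, map_smul, dot3_add_right, dot3_sub_right, dot3_smul_right,
    Function.comp_apply]
  ring

theorem continuous_hF {f : E3 → E3} (hf : Continuous f) : Continuous (hF f) := by
  unfold hF dot3
  fun_prop

theorem continuous_lie {f g : E3 → E3} (hf : ContDiff ℝ (⊤ : ℕ∞) f)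
    (hg : ContDiff ℝ (⊤ : ℕ∞) g) : Continuous (lie f g) :=
  ((hg.continuous_fderiv (by simp)).clm_apply hf.continuous).sub
    ((hf.continuous_fderiv (by simp)).clm_apply hg.continuous)

theorem hF_lie_self (f : E3 → E3) (l : E3 × E3) : hF (lie f f) l = 0 := by
  simp [lie, hF, dot3]

theorem hF_lie_swap (f g : E3 → E3) (l : E3 × E3) : hF (lie g f) l = -hF (lie f g) l := by
  simp only [hF, lie, dot3_sub_right]
  ring

/-- A continuous inequality holding almost everywhere on an open set holds everywhere on it. -/
theorem le_of_ae_le_on_isOpen {s : Set ℝ} (hs : IsOpen s) {f g : ℝ → ℝ}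
    (hf : ContinuousOn f s) (hg : ContinuousOn g s) (h : ∀ᵐ t, t ∈ s → f t ≤ g t) :
    ∀ t ∈ s, f t ≤ g t := by
  intro t ht
  by_contra! hlt
  have hopen : IsOpen (s ∩ {x | g x - f x < 0}) :=
    (hg.sub hf).isOpen_inter_preimage hs isOpen_Iio
  have hpos := hopen.measure_pos volume ⟨t, ht, by simpa using hlt⟩
  refine hpos.ne' (measure_mono_null ?_ (ae_iff.1 h))
  rintro x ⟨hxs, hx⟩ hle
  have hx' : g x - f x < 0 := hx
  linarith [hle hxs]

/-- **singular-arc formulas (4.13)–(4.14) and Goh-type bound.** If an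
extremal lies in the singular locus on `(τ₁, τ₂)` and the nondegeneracy condition
`h₀₁² + h₀₂² + h₁₂² ≠ 0` holds along it, then `h₁₂ ≠ 0` there, the control satisfies
a.e. `u = (−h₀₂/h₁₂, h₀₁/h₁₂)`, and `h₀₁² + h₀₂² ≤ h₁₂²` on `(τ₁, τ₂)`. -/
theorem statement17 (f0 f1 f2 : E3 → E3)
    (hf0 : ContDiff ℝ (⊤ : ℕ∞) f0) (hf1 : ContDiff ℝ (⊤ : ℕ∞) f1) (hf2 : ContDiff ℝ (⊤ : ℕ∞) f2)
    (hli : ∀ q : E3, LinearIndependent ℝ ![f1 q, f2 q])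
    (τ1 τ2 : ℝ) (hτ : τ1 < τ2) (u : ℝ → ℝ × ℝ) (lam : ℝ → E3 × E3)
    (hext : IsExtremal f0 f1 f2 u lam (Ioo τ1 τ2))
    (hsing : ∀ t ∈ Ioo τ1 τ2, lam t ∈ SingLocus f1 f2)
    (hnondeg : ∀ t ∈ Ioo τ1 τ2,
      hF (lie f0 f1) (lam t) ^ 2 + hF (lie f0 f2) (lam t) ^ 2
        + hF (lie f1 f2) (lam t) ^ 2 ≠ 0) :
    (∀ t ∈ Ioo τ1 τ2, hF (lie f1 f2) (lam t) ≠ 0) ∧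
    (∀ᵐ t, t ∈ Ioo τ1 τ2 →
      u t = (-hF (lie f0 f2) (lam t) / hF (lie f1 f2) (lam t),
             hF (lie f0 f1) (lam t) / hF (lie f1 f2) (lam t))) ∧
    (∀ t ∈ Ioo τ1 τ2,
      hF (lie f0 f1) (lam t) ^ 2 + hF (lie f0 f2) (lam t) ^ 2
        ≤ hF (lie f1 f2) (lam t) ^ 2) := by
  obtain ⟨⟨K, hK⟩, ⟨-, hu⟩, -, hae⟩ := hext
  have hzero : ∀ f, (∀ t ∈ Ioo τ1 τ2, hF f (lam t) = 0) → ∀ t ∈ Ioo τ1 τ2,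
      ∀ d, HasDerivAt (fun s => hF f (lam s)) d t → d = 0 := by
    intro f hf t ht d hd
    refine hd.unique ((hasDerivAt_const t (0 : ℝ)).congr_of_eventuallyEq ?_)
    filter_upwards [isOpen_Ioo.mem_nhds ht] with s hs using hf s hs
  have hlin : ∀ᵐ t, t ∈ Ioo τ1 τ2 →
      (u t).1 * hF (lie f1 f2) (lam t) = -hF (lie f0 f2) (lam t) ∧
      (u t).2 * hF (lie f1 f2) (lam t) = hF (lie f0 f1) (lam t) := by
    filter_upwards [hae] with t h ht
    obtain ⟨hx, ⟨w, hξ, hw⟩, -⟩ := h ht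
    have e1 := hzero f1 (fun s hs => (hsing s hs).1) t ht _
      (hasDerivAt_hF_extremal (hf1.differentiable (by simp) _) hx hξ hw)
    have e2 := hzero f2 (fun s hs => (hsing s hs).2) t ht _
      (hasDerivAt_hF_extremal (hf2.differentiable (by simp) _) hx hξ hw)
    rw [hF_lie_self, hF_lie_swap f1 f2] at e1
    rw [hF_lie_self] at e2
    constructor <;> linarith
  have hcont : ∀ {f g : E3 → E3}, ContDiff ℝ (⊤ : ℕ∞) f → ContDiff ℝ (⊤ : ℕ∞) g →
      ContinuousOn (fun t => hF (lie f g) (lam t)) (Ioo τ1 τ2) := fun hf hg =>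
    (continuous_hF (continuous_lie hf hg)).comp_continuousOn hK.continuousOn
  have hbound : ∀ t ∈ Ioo τ1 τ2,
      hF (lie f0 f1) (lam t) ^ 2 + hF (lie f0 f2) (lam t) ^ 2
        ≤ hF (lie f1 f2) (lam t) ^ 2 := by
    refine le_of_ae_le_on_isOpen isOpen_Ioo
      (((hcont hf0 hf1).pow 2).add ((hcont hf0 hf2).pow 2)) ((hcont hf1 hf2).pow 2) ?_
    filter_upwards [hlin] with t h ht
    obtain ⟨e1, e2⟩ := h ht
    have hdisk : (u t).1 ^ 2 + (u t).2 ^ 2 ≤ 1 := hu t ht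
    calc hF (lie f0 f1) (lam t) ^ 2 + hF (lie f0 f2) (lam t) ^ 2
        = ((u t).1 ^ 2 + (u t).2 ^ 2) * hF (lie f1 f2) (lam t) ^ 2 := by
          rw [← e2, ← neg_sq (hF (lie f0 f2) (lam t)), ← e1]; ring
      _ ≤ 1 * hF (lie f1 f2) (lam t) ^ 2 := by gcongr
      _ = hF (lie f1 f2) (lam t) ^ 2 := one_mul _
  have hne : ∀ t ∈ Ioo τ1 τ2, hF (lie f1 f2) (lam t) ≠ 0 := by
    intro t ht h0
    have hb := hbound t ht
    refine hnondeg t ht (le_antisymm ?_ (by positivity))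
    rw [h0] at hb ⊢
    linarith
  refine ⟨hne, ?_, hbound⟩
  filter_upwards [hlin] with t h ht
  exact Prod.ext (eq_div_of_mul_eq (hne t ht) (h ht).1) (eq_div_of_mul_eq (hne t ht) (h ht).2)
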